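/- Let k ≥ 2 be a natural number and let G be a graph of finite girth g whose average degree is at least 6k. Then there exists an odd number r ≥ 3 such that G contains cycles of every even length in the interval [r, r + (g − 2)k], or G contains cycles of every odd length in the interval [r, r + (g − 2)k]. -/

import Mathlib

theorem periodic_forall_of_window {D : ℤ → Prop} {d : ℤ} (hD : Function.Periodic D d) (hd : 0 < d)
    (s : ℤ) (h : ∀ x, s ≤ x → x < s + d → D x) (x : ℤ) : D x := by
  obtain ⟨y, hy, hxy⟩ := hD.exists_mem_Ico hd x s
  rw [hxy]
  exact h y hy.1 hy.2

theorem periodic_two_of_chord {C : ℤ → Prop} {n r l : ℤ}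
    (hn : Function.Periodic C n) (hl : Function.Periodic C l)
    (hr : 2 ≤ r) (hrn : 2 * r ≤ n) (hl0 : 0 < l) (hln : l < n)
    (h₁ : ∀ a b, 0 ≤ a → 0 ≤ b → a + b + 1 = l → a + b < r → C a = C (r - b))
    (h₂ : ∀ a b, 0 ≤ a → 0 ≤ b → a + b + 1 = l → a + b + r < n → C (-a) = C (r + b))
    (h₃ : ∀ a b, 0 ≤ a → 0 ≤ b → a + b + 1 = l → b < r → a < n - r → C (-a) = C (r - b))
    (h₄ : ∀ a b, 0 ≤ a → 0 ≤ b → a + b + 1 = l → a < r → b < n - r → C a = C (r + b)) :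
    Function.Periodic C 2 := by
  have shift : ∀ {d : ℤ}, Function.Periodic C d → ∀ e : ℤ,
      Function.Periodic (fun x => C (x + e)) d := fun h e x => by
    show C _ = C _
    rw [← h (x + e)]; congr 1; ring
  have refl : ∀ {d : ℤ}, Function.Periodic C d → ∀ e : ℤ,
      Function.Periodic (fun x => C (e - x)) d := fun {d} h e x => by
    have := h (e - (x + d))
    show C _ = C _
    rw [← this]; congr 1; ring
  have eqv : ∀ {d : ℤ} {P Q : ℤ → Prop}, Function.Periodic P d → Function.Periodic Q d →
      Function.Periodic (fun x => P x = Q x) d := fun hP hQ x => by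
    simp only [hP x, hQ x]
  have back : ∀ x, C (x - l) = C x := hl.sub_eq
  by_cases hlr : l ≤ r
  · have A : ∀ x, C x = C (x + (r + 1)) := by
      refine periodic_forall_of_window (eqv hl (shift hl _)) hl0 0 fun x hx hx' => ?_
      rw [h₁ x (l - 1 - x) hx (by lia) (by lia) (by lia), ← hl]
      congr 1; ring
    have B : ∀ x, C (0 - x) = C (r - 1 - x) := by
      refine periodic_forall_of_window (eqv (refl hl _) (refl hl _)) hl0 0 fun x hx hx' => ?_
      have := h₂ x (l - 1 - x) hx (by lia) (by lia) (by lia)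
      rw [zero_sub, this, ← hl (r - 1 - x)]
      congr 1; ring
    intro x
    have h1 := A (x + 1 - r)
    have h2 := B (r - 1 - x)
    rw [show x + 1 - r + (r + 1) = x + 2 by ring] at h1
    rw [show 0 - (r - 1 - x) = x + 1 - r by ring, sub_sub_cancel] at h2
    exact h1.symm.trans h2
  by_cases hlr' : l ≤ n - r
  · have B : Function.Periodic C (r - 1) := by
      have : ∀ x, C (0 - x) = C (r - 1 - x) := by
        refine periodic_forall_of_window (eqv (refl hl _) (refl hl _)) hl0 0 fun x hx hx' => ?_
        have := h₂ x (l - 1 - x) hx (by lia) (by lia) (by lia)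
        rw [zero_sub, this, ← hl (r - 1 - x)]
        congr 1; ring
      intro x
      have := this (-x)
      rw [show x + (r - 1) = r - 1 - -x by ring, ← this]
      congr 1; ring
    have E : ∀ x, C (x + 1) = C (1 - x) := by
      refine periodic_forall_of_window (eqv (shift B _) (refl B _)) (by lia) 0 fun x hx hx' => ?_
      have := h₃ (l - 1 - x) x (by lia) hx (by lia) (by lia) (by lia)
      rw [← B (1 - x), show 1 - x + (r - 1) = r - x by ring, ← this, ← back]
      congr 1; ring
    have F : ∀ x, C (x + 0) = C (0 - x) := by
      refine periodic_forall_of_window (eqv (shift B _) (refl B _)) (by lia) 0 fun x hx hx' => ?_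
      have := h₄ x (l - 1 - x) (by lia) (by lia) (by lia) (by lia) (by lia)
      rw [add_zero, this, ← B (0 - x), ← hl (0 - x + (r - 1))]
      congr 1; ring
    intro x
    have h1 := E (x + 1)
    have h2 := F x
    ring_nf at h1 h2 ⊢
    rw [h2, ← h1]
  · have hnl : Function.Periodic C (n - l) := hn.sub_period hl
    have A : ∀ x, C (0 - x) = C (x + (r + 1)) := by
      refine periodic_forall_of_window (eqv (refl hnl _) (shift hnl _)) (by lia) (l - r)
        fun x hx hx' => ?_
      have := h₃ x (l - 1 - x) (by lia) (by lia) (by lia) (by lia) (by lia)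
      rw [zero_sub, this, ← hl (r - _)]
      congr 1; ring
    have B : ∀ x, C (x + 0) = C (r - 1 - x) := by
      refine periodic_forall_of_window (eqv (shift hnl _) (refl hnl _)) (by lia) (l - n + r)
        fun x hx hx' => ?_
      have := h₄ x (l - 1 - x) (by lia) (by lia) (by lia) (by lia) (by lia)
      rw [add_zero, this, ← hl (r - 1 - x)]
      congr 1; ring
    intro x
    have h1 := A (r - 1 - (r - 1 - (-(x + 2))))
    have h2 := B (r - 1 - x)
    ring_nf at h1 h2 ⊢
    rw [h1, h2]

namespace SimpleGraph

variable {V : Type*}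

/-- `p 0, …, p l` is a path of length `l` in `H`. -/
def IsPathSeq (H : SimpleGraph V) (l : ℕ) (p : ℕ → V) : Prop :=
  (∀ i < l, H.Adj (p i) (p (i + 1))) ∧ ∀ i ≤ l, ∀ j ≤ l, p i = p j → i = j

/-- `f` runs periodically around a cycle of length `n` in `H`. -/
def IsCyclicSeq (H : SimpleGraph V) (n : ℤ) (f : ℤ → V) : Prop :=
  Function.Periodic f n ∧ (∀ x, H.Adj (f x) (f (x + 1))) ∧
    ∀ x y, x - y < n → y - x < n → f x = f y → x = y

theorem IsPathSeq.reverse {H : SimpleGraph V} {l : ℕ} {p : ℕ → V} (hp : H.IsPathSeq l p) :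
    H.IsPathSeq l (fun i => p (l - i)) := by
  refine ⟨fun i hi => ?_, fun i hi j hj h => ?_⟩
  · have := hp.1 (l - (i + 1)) (by lia)
    rw [show l - (i + 1) + 1 = l - i by lia] at this
    exact this.symm
  · have := hp.2 _ (by lia) _ (by lia) h
    lia

theorem exists_walk_support_eq_map_range {G : SimpleGraph V} (n : ℕ) (p : ℕ → V)
    (hp : ∀ i < n, G.Adj (p i) (p (i + 1))) :
    ∃ w : G.Walk (p 0) (p n), w.length = n ∧ w.support = (List.range (n + 1)).map p := by
  induction n generalizing p with
  | zero => exact ⟨.nil, rfl, by simp⟩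
  | succ n ih =>
    obtain ⟨w, hw, hs⟩ := ih (fun i => p (i + 1)) fun i hi => hp (i + 1) (by lia)
    refine ⟨.cons (hp 0 (by lia)) w, by simp [hw], ?_⟩
    rw [Walk.support_cons, hs, List.range_succ_eq_map (n := n + 1)]
    simp [Function.comp_def]

/-- A path of length at least two whose ends are adjacent closes up to a cycle. -/
theorem IsPathSeq.exists_isCycle {G : SimpleGraph V} {n : ℕ} {p : ℕ → V} (hp : G.IsPathSeq n p)
    (hn : 2 ≤ n) (hadj : G.Adj (p n) (p 0)) :
    ∃ (v : V) (c : G.Walk v v), c.IsCycle ∧ c.length = n + 1 := by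
  obtain ⟨w, hw, hs⟩ := exists_walk_support_eq_map_range n p hp.1
  refine ⟨_, .cons hadj w, ?_, by simp [hw]⟩
  rw [Walk.isCycle_iff_isPath_tail_and_le_length]
  refine ⟨?_, by simp [hw]; lia⟩
  have : w.IsPath := by
    rw [Walk.isPath_def, hs]
    refine List.Nodup.map_on (fun i hi j hj h => hp.2 i ?_ j ?_ h) List.nodup_range <;>
      simp at hi hj <;> lia
  simpa using this

theorem IsCyclicSeq.isPathSeq {H : SimpleGraph V} {n : ℤ} {f : ℤ → V} (hf : H.IsCyclicSeq n f)
    {l : ℕ} (hl : l < n) (x : ℤ) : H.IsPathSeq l (fun j => f (x + j)) := by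
  refine ⟨fun i hi => ?_, fun i hi j hj h => ?_⟩
  · simpa [add_assoc] using hf.2.1 (x + i)
  · have := hf.2.2 _ _ (by lia) (by lia) h
    lia

theorem IsCyclicSeq.neg {H : SimpleGraph V} {n : ℤ} {f : ℤ → V} (hf : H.IsCyclicSeq n f) :
    H.IsCyclicSeq n (fun x => f (-x)) := by
  refine ⟨fun x => ?_, fun x => ?_, fun x y h h' he => ?_⟩
  · show f _ = f _
    rw [← hf.1 (-(x + n))]; congr 1; ring
  · have := (hf.2.1 (-(x + 1))).symm
    rwa [show -(x + 1) + 1 = -x by ring] at this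
  · have := hf.2.2 _ _ (by lia) (by lia) he
    lia

/-- The path that runs along a cycle to one end of a chord, takes the chord, and runs along the
cycle again. The signs `u` and `v` are the directions of the two runs. -/
theorem IsCyclicSeq.isPathSeq_chord {H : SimpleGraph V} {n r : ℤ} {f : ℤ → V}
    (hf : H.IsCyclicSeq n f) (hr : H.Adj (f 0) (f r)) {a b : ℕ} {u v : ℤ}
    (hu : u = 1 ∨ u = -1) (hv : v = 1 ∨ v = -1) (ha : a < n) (hb : b < n)
    (hdisj : ∀ s t : ℤ, 0 ≤ s → s ≤ a → 0 ≤ t → t ≤ b →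
      u * s ≠ r + v * t ∧ u * s - (r + v * t) < n ∧ r + v * t - u * s < n) :
    H.IsPathSeq (a + b + 1)
      (fun j => if j ≤ a then f (u * (a - j)) else f (r + v * (j - a - 1))) := by
  refine ⟨fun i hi => ?_, fun i hi j hj h => ?_⟩
  · rcases lt_trichotomy i a with h | rfl | h
    · simp only [h.le, if_true, Nat.succ_le_of_lt h]
      rcases hu with rfl | rfl
      · have := (hf.2.1 (1 * (a - (i + 1 : ℕ)))).symm
        convert this using 2
        push_cast; ring
      · have := hf.2.1 (-1 * (a - i))
        convert this using 2
        push_cast; ring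
    · simpa using hr
    · simp only [h.not_ge, if_false, show ¬ i + 1 ≤ a by lia]
      rcases hv with rfl | rfl
      · have := hf.2.1 (r + 1 * (i - a - 1))
        convert this using 2
        push_cast; ring
      · have := (hf.2.1 (r + -1 * ((i + 1 : ℕ) - a - 1))).symm
        convert this using 2
        push_cast; ring
  · have key : ∀ i j : ℕ, i ≤ a → a < j → j ≤ a + b + 1 →
        f (u * (a - i)) ≠ f (r + v * (j - a - 1)) := fun i j hi hj hj' he => by
      obtain ⟨h1, h2, h3⟩ := hdisj (a - i) (j - a - 1) (by lia) (by lia) (by lia) (by lia)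
      exact h1 (hf.2.2 _ _ h2 h3 he)
    by_cases hia : i ≤ a <;> by_cases hja : j ≤ a <;> simp only [hia, hja, if_true, if_false] at h
    · have : u * (a - i) = u * (a - j) := by
        refine hf.2.2 _ _ ?_ ?_ h <;> rcases hu with rfl | rfl <;> lia
      rcases hu with rfl | rfl <;> lia
    · exact (key i j hia (by lia) hj h).elim
    · exact (key j i hja (by lia) hi h.symm).elim
    · have : r + v * (i - a - 1) = r + v * (j - a - 1) := by
        refine hf.2.2 _ _ ?_ ?_ h <;> rcases hv with rfl | rfl <;> lia
      rcases hv with rfl | rfl <;> lia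

/-- If no path of length `l` inside a cycle with a chord joins the two parts of a partition of its
vertices, then the partition is periodic along the cycle with periods `l` and `2`. -/
theorem IsCyclicSeq.periodic_of_forall_isPathSeq {H : SimpleGraph V} {n r : ℤ} {f : ℤ → V}
    (hf : H.IsCyclicSeq n f) (hr : H.Adj (f 0) (f r)) (hr2 : 2 ≤ r) (hrn : r + 2 ≤ n)
    {l : ℕ} (hl : 0 < l) (hln : l < n) (c : V → Prop)
    (hc : ∀ p : ℕ → V, H.IsPathSeq l p → (∀ i, p i ∈ Set.range f) → c (p 0) → c (p l)) :
    Function.Periodic (fun x => c (f x)) l ∧ Function.Periodic (fun x => c (f x)) 2 := by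
  have hc' : ∀ p : ℕ → V, H.IsPathSeq l p → (∀ i, p i ∈ Set.range f) → c (p 0) = c (p l) := by
    refine fun p hp hpf => propext ⟨hc p hp hpf, fun h => ?_⟩
    simpa using hc _ hp.reverse (fun i => hpf _) (by simpa using h)
  have half : ∀ (f : ℤ → V) (r : ℤ), H.IsCyclicSeq n f → H.Adj (f 0) (f r) → 2 ≤ r → 2 * r ≤ n →
      (∀ p : ℕ → V, H.IsPathSeq l p → (∀ i, p i ∈ Set.range f) → c (p 0) = c (p l)) →
      Function.Periodic (fun x => c (f x)) l ∧ Function.Periodic (fun x => c (f x)) 2 := by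
    clear hc hc' hrn hr2 hr hf r f
    intro f r hf hr hr2 hrn hc
    have per : Function.Periodic (fun x => c (f x)) l := fun x => by
      have := hc _ (hf.isPathSeq hln x) fun i => ⟨_, rfl⟩
      simpa using this.symm
    have chord : ∀ a b u v : ℤ, (u = 1 ∨ u = -1) → (v = 1 ∨ v = -1) → 0 ≤ a → 0 ≤ b →
        a + b + 1 = l →
        (∀ s t : ℤ, 0 ≤ s → s ≤ a → 0 ≤ t → t ≤ b →
          u * s ≠ r + v * t ∧ u * s - (r + v * t) < n ∧ r + v * t - u * s < n) →
        c (f (u * a)) = c (f (r + v * b)) := by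
      intro a b u v hu hv ha hb hab hd
      lift a to ℕ using ha
      lift b to ℕ using hb
      obtain rfl : a + b + 1 = l := by lia
      have := hc _ (hf.isPathSeq_chord hr hu hv (by lia) (by lia) hd) fun i => by
        split_ifs <;> exact ⟨_, rfl⟩
      convert this using 2
      · simp
      · simp only [show ¬ a + b + 1 ≤ a by lia, if_false]
        congr 3; push_cast; ring
    refine ⟨per, periodic_two_of_chord (hf.1.comp c) per hr2 hrn (by lia) hln ?_ ?_ ?_ ?_⟩ <;>
      intro a b ha hb hab
    · intro h
      have := chord a b 1 (-1) (by simp) (by simp) ha hb hab (by intros; lia)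
      simpa [sub_eq_add_neg] using this
    · intro h
      have := chord a b (-1) 1 (by simp) (by simp) ha hb hab (by intros; lia)
      simpa using this
    · intro h h'
      have := chord a b (-1) (-1) (by simp) (by simp) ha hb hab (by intros; lia)
      simpa [sub_eq_add_neg] using this
    · intro h h'
      have := chord a b 1 1 (by simp) (by simp) ha hb hab (by intros; lia)
      simpa using this
  rcases le_total (2 * r) n with h | h
  · exact half f r hf hr hr2 h hc'
  · have hr' : f (-(n - r)) = f r := by
      rw [← hf.1]; congr 1; ring
    obtain ⟨h1, h2⟩ := half (fun x => f (-x)) (n - r) hf.neg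
      (by simpa only [hr', neg_zero] using hr) (by lia) (by lia) fun p hp hpf => hc' p hp fun i => by
        obtain ⟨x, hx⟩ := hpf i
        exact ⟨_, hx⟩
    have flip : ∀ {d : ℤ}, Function.Periodic (fun x => c (f (-x))) d →
        Function.Periodic (fun x => c (f x)) d := fun {d} h x => by
      have := h (-(x + d))
      simp only [neg_neg, show -(-(x + d) + d) = x by ring] at this
      exact this.symm
    exact ⟨flip h1, flip h2⟩

/-- The largest of `k + 1` positive integers with gaps at least `d` is at least `1 + d * k`. -/
theorem _root_.Finset.exists_mem_add_mul_le {d k : ℕ} (N : Finset ℕ) (hcard : k + 1 ≤ N.card)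
    (hsep : ∀ i ∈ N, ∀ j ∈ N, i < j → i + d ≤ j) (hpos : ∀ i ∈ N, 1 ≤ i) :
    ∃ m ∈ N, 1 + d * k ≤ m ∧ ∀ i ∈ N, i ≤ m := by
  induction k generalizing N with
  | zero =>
    have hN : N.Nonempty := Finset.card_pos.1 (by lia)
    exact ⟨_, N.max'_mem hN, by simpa using hpos _ (N.max'_mem hN), fun i hi => N.le_max' i hi⟩
  | succ k ih =>
    have hN : N.Nonempty := Finset.card_pos.1 (by lia)
    have hm := N.max'_mem hN
    obtain ⟨m', hm', h, -⟩ := ih (N.erase (N.max' hN))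
      (by rw [Finset.card_erase_of_mem hm]; lia)
      (fun i hi j hj => hsep i (Finset.mem_of_mem_erase hi) j (Finset.mem_of_mem_erase hj))
      fun i hi => hpos i (Finset.mem_of_mem_erase hi)
    rw [Finset.mem_erase] at hm'
    have hlt : m' < N.max' hN := lt_of_le_of_ne (N.le_max' _ hm'.2) hm'.1
    have := hsep _ hm'.2 _ hm hlt
    exact ⟨_, hm, by rw [Nat.mul_succ]; lia, fun i hi => N.le_max' i hi⟩

open Classical in
/-- A set spanning average degree at least `2k` has a nonempty subset spanning minimum degree more
than `k`. -/
theorem exists_subset_forall_lt_card_neighbors (H : SimpleGraph V) {k : ℕ} (hk : 0 < k)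
    {S : Finset V} (hS : S.Nonempty)
    (hcard : 2 * k * S.card ≤ ((S ×ˢ S).filter fun x => H.Adj x.1 x.2).card) :
    ∃ T : Finset V, T.Nonempty ∧ ∀ v ∈ T, k + 1 ≤ (T.filter fun w => H.Adj v w).card := by
  induction hs : S.card using Nat.strong_induction_on generalizing S with
  | _ s ih =>
    subst hs
    by_contra hcon
    have hST : ¬ ∀ v ∈ S, k + 1 ≤ (S.filter fun w => H.Adj v w).card := fun h => hcon ⟨S, hS, h⟩
    push Not at hST
    obtain ⟨v, hv, hdeg⟩ := hST
    have hle : ((S ×ˢ S).filter fun x => H.Adj x.1 x.2).card ≤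
        ((S.erase v ×ˢ S.erase v).filter fun x => H.Adj x.1 x.2).card + 2 * k := by
      have hsub : (S ×ˢ S).filter (fun x => H.Adj x.1 x.2) ⊆
          (S.erase v ×ˢ S.erase v).filter (fun x => H.Adj x.1 x.2) ∪
          ((S.filter fun w => H.Adj v w).image (fun w => (v, w)) ∪
            (S.filter fun w => H.Adj v w).image fun w => (w, v)) := by
        rintro ⟨x, y⟩ hxy
        simp only [Finset.mem_filter, Finset.mem_product, Finset.mem_union, Finset.mem_image,
          Finset.mem_erase, Prod.mk.injEq] at hxy ⊢
        by_cases hx : x = v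
        · subst hx
          exact Or.inr (Or.inl ⟨y, ⟨hxy.1.2, hxy.2⟩, rfl, rfl⟩)
        by_cases hy : y = v
        · subst hy
          exact Or.inr (Or.inr ⟨x, ⟨hxy.1.1, hxy.2.symm⟩, rfl, rfl⟩)
        exact Or.inl ⟨⟨⟨hx, hxy.1.1⟩, hy, hxy.1.2⟩, hxy.2⟩
      have h1 := Finset.card_le_card hsub
      have h2 := Finset.card_union_le ((S.erase v ×ˢ S.erase v).filter fun x => H.Adj x.1 x.2)
        ((S.filter fun w => H.Adj v w).image (fun w => (v, w)) ∪
            (S.filter fun w => H.Adj v w).image fun w => (w, v))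
      have h3 := Finset.card_union_le ((S.filter fun w => H.Adj v w).image fun w => (v, w))
        ((S.filter fun w => H.Adj v w).image fun w => (w, v))
      have h4 := Finset.card_image_le (s := S.filter fun w => H.Adj v w) (f := fun w => (v, w))
      have h5 := Finset.card_image_le (s := S.filter fun w => H.Adj v w) (f := fun w => (w, v))
      lia
    have herase := Finset.card_erase_add_one hv
    by_cases hne : (S.erase v).Nonempty
    · refine hcon (ih (S.erase v).card (by lia) hne ?_ rfl)
      rw [← herase] at hcard
      lia
    · rw [Finset.not_nonempty_iff_eq_empty] at hne
      have hSv : S = {v} := by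
        rw [← Finset.insert_erase hv, hne, insert_empty_eq]
      subst hSv
      simp only [Finset.card_singleton, mul_one, Finset.singleton_product_singleton,
        Finset.filter_singleton, SimpleGraph.irrefl, if_false, Finset.card_empty] at hcard hdeg
      lia

open Classical in
/-- A finite graph of minimum degree at least `k + 1` contains a long cycle with a chord. -/
theorem exists_isCyclicSeq_chord {H : SimpleGraph V} {k g : ℕ} (hk : 2 ≤ k)
    (hg : ∀ (v : V) (c : H.Walk v v), c.IsCycle → g ≤ c.length) {T : Finset V}
    (hT : T.Nonempty) (hdeg : ∀ v ∈ T, k + 1 ≤ (T.filter fun w => H.Adj v w).card) :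
    ∃ (n r : ℤ) (f : ℤ → V), H.IsCyclicSeq n f ∧ H.Adj (f 0) (f r) ∧ 2 ≤ r ∧ r + 2 ≤ n ∧
      (((g - 2) * k + 2 : ℕ) : ℤ) ≤ n := by
  obtain ⟨m, ⟨p, hp, hpT⟩, hmax⟩ : ∃ m, (∃ p, H.IsPathSeq m p ∧ ∀ i ≤ m, p i ∈ T) ∧
      ¬ ∃ p, H.IsPathSeq (m + 1) p ∧ ∀ i ≤ m + 1, p i ∈ T := by
    by_contra! hcon
    have hall : ∀ m, ∃ p, H.IsPathSeq m p ∧ ∀ i ≤ m, p i ∈ T := fun m => by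
      induction m with
      | zero =>
        obtain ⟨v, hv⟩ := hT
        exact ⟨fun _ => v, ⟨by simp, by simp⟩, fun _ _ => hv⟩
      | succ m ih => exact hcon m ih
    obtain ⟨p, hp, hpT⟩ := hall T.card
    have h1 : (Finset.range (T.card + 1)).card ≤ T.card :=
      Finset.card_le_card_of_injOn p
        (fun i hi => hpT i (by simp at hi; lia))
        (fun i hi j hj h => hp.2 i (by simp at hi; lia) j (by simp at hj; lia) h)
    simp at h1
  set N := (Finset.range (m + 1)).filter fun i => H.Adj (p 0) (p i) with hN
  have hNmem : ∀ i, i ∈ N ↔ i ≤ m ∧ H.Adj (p 0) (p i) := fun i => by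
    simp [hN]
  have hpos : ∀ i ∈ N, 1 ≤ i := fun i hi => by
    rcases Nat.eq_zero_or_pos i with rfl | h
    · exact (H.irrefl ((hNmem 0).1 hi).2).elim
    · exact h
  have hNcard : k + 1 ≤ N.card := by
    refine (hdeg _ (hpT 0 (by lia))).trans
      ((Finset.card_le_card (t := N.image p) fun w hw => ?_).trans Finset.card_image_le)
    rw [Finset.mem_filter] at hw
    rw [Finset.mem_image]
    by_contra! hcon
    refine hmax ⟨fun i => if i = 0 then w else p (i - 1), ⟨fun i hi => ?_, ?_⟩, fun i hi => ?_⟩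
    · rcases i with - | i
      · simpa using hw.2.symm
      · simpa using hp.1 i (by lia)
    · have hne : ∀ i ≤ m, w ≠ p i := fun i hi h =>
        hcon i ((hNmem i).2 ⟨hi, h ▸ hw.2⟩) h.symm
      rintro (- | i) hi (- | j) hj h
      · rfl
      · exact (hne j (by lia) (by simpa using h)).elim
      · exact (hne i (by lia) (by simpa using h.symm)).elim
      · simpa using hp.2 i (by lia) j (by lia) (by simpa using h)
    · rcases i with - | i
      · simpa using hw.1
      · simpa using hpT i (by lia)
  have hsep : ∀ i ∈ N, ∀ j ∈ N, i < j → i + (g - 2) ≤ j := fun i hi j hj hij => by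
    have hi1 := hpos i hi
    rw [hNmem] at hi hj
    have hq : H.IsPathSeq (j - i + 1) fun t => if t = 0 then p 0 else p (i + t - 1) := by
      refine ⟨fun t ht => ?_, ?_⟩
      · rcases t with - | t
        · simpa using hi.2
        · simpa [← add_assoc] using hp.1 (i + t) (by lia)
      · rintro (- | s) hs (- | t) ht h
        · rfl
        · have := hp.2 0 (by lia) (i + t) (by lia) (by simpa using h)
          lia
        · have := hp.2 (i + s) (by lia) 0 (by lia) (by simpa using h)
          lia
        · have := hp.2 (i + s) (by lia) (i + t) (by lia) (by simpa using h)
          lia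
    obtain ⟨v, c, hc, hlen⟩ := hq.exists_isCycle (by lia) (by
      simpa [show i + (j - i) = j by lia] using hj.2.symm)
    have := hg v c hc
    lia
  obtain ⟨M, hM, hMge, hMmax⟩ := N.exists_mem_add_mul_le hNcard hsep hpos
  obtain ⟨r, hr, hr1, hrM⟩ : ∃ r ∈ N, 2 ≤ r ∧ r < M := by
    by_contra! hcon
    have : N ⊆ {1, M} := fun i hi => by
      have h1 := hpos i hi
      have h2 := hMmax i hi
      have h3 := hcon i hi
      simp only [Finset.mem_insert, Finset.mem_singleton]
      lia
    have := (Finset.card_le_card this).trans Finset.card_le_two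
    lia
  have hM' := (hNmem M).1 hM
  have hmod : ∀ x : ℤ, 0 ≤ x % (M + 1 : ℤ) ∧ x % (M + 1 : ℤ) < M + 1 := fun x =>
    ⟨Int.emod_nonneg _ (by lia), Int.emod_lt_of_pos _ (by lia)⟩
  refine ⟨M + 1, r, fun x => p (x % (M + 1 : ℤ)).toNat, ⟨fun x => ?_, fun x => ?_, ?_⟩, ?_,
    by lia, by lia, by push_cast at hMge ⊢; lia⟩
  · simp
  · obtain ⟨h0, h1⟩ := hmod x
    by_cases hx : x % (M + 1 : ℤ) = M
    · have : (x + 1) % (M + 1 : ℤ) = 0 := by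
        rw [Int.add_emod, hx]
        rcases Nat.eq_zero_or_pos M with h | h
        · lia
        · rw [Int.emod_eq_of_lt (a := 1) (by lia) (by lia), Int.emod_self]
      simp only [hx, this]
      simpa using hM'.2.symm
    · have : (x + 1) % (M + 1 : ℤ) = x % (M + 1 : ℤ) + 1 := by
        rw [Int.add_emod, Int.emod_eq_of_lt (a := 1) (by lia) (by lia)]
        exact Int.emod_eq_of_lt (by lia) (by lia)
      simp only [this, Int.toNat_add h0 zero_le_one]
      exact hp.1 _ (by lia)
  · intro x y h h' he
    obtain ⟨h0, h1⟩ := hmod x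
    obtain ⟨h2, h3⟩ := hmod y
    have := hp.2 _ (by lia) _ (by lia) he
    have hxy : x % (M + 1 : ℤ) = y % (M + 1 : ℤ) := by lia
    have hd : (M + 1 : ℤ) ∣ x - y := Int.ModEq.dvd (Int.ModEq.symm hxy)
    have := Int.eq_zero_of_abs_lt_dvd hd (by rw [abs_lt]; lia)
    lia
  · simp only [Int.zero_emod, Int.toNat_zero]
    rw [Int.emod_eq_of_lt (by lia) (by lia)]
    simpa using ((hNmem r).1 hr).2

/-- A layering of `G` by breadth-first search from a root in each component: `lay` is the layer of
a vertex, `par` its parent and `root` the root of its component. -/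
structure IsLayering (G : SimpleGraph V) (lay : V → ℕ) (par root : V → V) : Prop where
  lay_le : ∀ v w, G.Adj v w → lay v ≤ lay w + 1
  root_eq : ∀ v w, G.Adj v w → root v = root w
  adj_par : ∀ v, lay v ≠ 0 → G.Adj v (par v)
  lay_par : ∀ v, lay v ≠ 0 → lay (par v) + 1 = lay v
  eq_root : ∀ v, lay v = 0 → v = root v

theorem exists_isLayering (G : SimpleGraph V) :
    ∃ (lay : V → ℕ) (par root : V → V), G.IsLayering lay par root := by
  classical
  set root : V → V := fun v => (G.connectedComponentMk v).out with hroot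
  have hreach : ∀ v, G.Reachable (root v) v := fun v =>
    ConnectedComponent.exact (Quot.out_eq (G.connectedComponentMk v))
  have hadj : ∀ v w, G.Adj v w → root v = root w := fun v w h => by
    simp only [hroot, ConnectedComponent.sound h.reachable]
  have hpar : ∀ v, ∃ w, G.dist (root v) v ≠ 0 →
      G.Adj v w ∧ G.dist (root w) w + 1 = G.dist (root v) v := fun v => by
    obtain ⟨p, hp⟩ := (hreach v).exists_walk_length_eq_dist
    by_cases h0 : G.dist (root v) v = 0
    · exact ⟨v, fun h => (h h0).elim⟩
    have hnil : ¬ p.Nil := by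
      rw [← Walk.length_eq_zero_iff]; lia
    have ha := p.adj_penultimate hnil
    refine ⟨p.penultimate, fun _ => ⟨ha.symm, ?_⟩⟩
    have h1 : G.dist (root v) p.penultimate ≤ p.length - 1 := by
      have := dist_le p.dropLast
      simpa using this
    have h2 : G.dist (root v) v ≤ G.dist (root v) p.penultimate + 1 := by
      obtain ⟨q, hq⟩ := ((hreach v).trans ha.symm.reachable).exists_walk_length_eq_dist
      rw [← hq]
      simpa using dist_le (q.concat ha)
    rw [hadj _ _ ha]
    lia
  choose par hpar using hpar
  refine ⟨fun v => G.dist (root v) v, par, root, fun v w h => ?_, hadj,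
    fun v hv => (hpar v hv).1, fun v hv => (hpar v hv).2, fun v hv => ?_⟩
  · obtain ⟨q, hq⟩ := (hreach w).exists_walk_length_eq_dist
    rw [hadj v w h, ← hq]
    simpa using dist_le (q.concat h.symm)
  · exact ((hreach v).dist_eq_zero_iff.1 hv).symm

namespace IsLayering

variable {G : SimpleGraph V} {lay : V → ℕ} {par root : V → V}

theorem lay_iterate (hL : G.IsLayering lay par root) {v : V} {j : ℕ} (hj : j ≤ lay v) :
    lay (par^[j] v) + j = lay v := by
  induction j with
  | zero => rfl
  | succ j ih =>
    have h := ih (by lia)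
    rw [Function.iterate_succ_apply']
    have := hL.lay_par (par^[j] v) (by lia)
    lia

theorem adj_iterate (hL : G.IsLayering lay par root) {v : V} {j : ℕ} (hj : j < lay v) :
    G.Adj (par^[j] v) (par^[j + 1] v) := by
  have h := hL.lay_iterate hj.le
  rw [Function.iterate_succ_apply']
  exact hL.adj_par _ (by lia)

theorem root_iterate (hL : G.IsLayering lay par root) {v : V} {j : ℕ} (hj : j ≤ lay v) :
    root (par^[j] v) = root v := by
  induction j with
  | zero => rfl
  | succ j ih => rw [← hL.root_eq _ _ (hL.adj_iterate hj), ih (by lia)]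

theorem iterate_lay (hL : G.IsLayering lay par root) (v : V) : par^[lay v] v = root v := by
  rw [hL.eq_root (par^[lay v] v) (by have := hL.lay_iterate (le_refl (lay v)); lia),
    hL.root_iterate le_rfl]

/-- A path above layer `i` between two vertices of layer `i` closes up through the first common
ancestor of its ends. -/
theorem exists_isCycle (hL : G.IsLayering lay par root) {i l h : ℕ} {p : ℕ → V}
    (hp : G.IsPathSeq l p) (hl : 1 ≤ l) (hlay : ∀ t ≤ l, i ≤ lay (p t)) (h0 : lay (p 0) = i)
    (hlast : lay (p l) = i) (hh : 1 ≤ h) (hhi : h ≤ i)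
    (hne : ∀ j < h, par^[j] (p 0) ≠ par^[j] (p l)) (heq : par^[h] (p 0) = par^[h] (p l)) :
    ∃ (v : V) (c : G.Walk v v), c.IsCycle ∧ c.length = 2 * h + l := by
  obtain ⟨q, hq₁, hq₂, hq₃⟩ : ∃ q : ℕ → V, (∀ t ≤ l, q t = p t) ∧
      (∀ j ≤ h, q (l + j) = par^[j] (p l)) ∧
      (∀ j < h, q (l + h + j) = par^[h - j] (p 0)) := by
    refine ⟨fun t => if t ≤ l then p t else if t ≤ l + h then par^[t - l] (p l)
      else par^[l + 2 * h - t] (p 0), fun t ht => by simp [ht], fun j hj => ?_, fun j hj => ?_⟩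
    · rcases Nat.eq_zero_or_pos j with rfl | hj0
      · simp
      · simp [show ¬ l + j ≤ l by lia, hj]
    · rcases Nat.eq_zero_or_pos j with rfl | hj0
      · simp [show h ≠ 0 by lia, heq]
      · simp only [show ¬ l + h + j ≤ l by lia, show ¬ l + h + j ≤ l + h by lia, if_false]
        rw [show l + 2 * h - (l + h + j) = h - j by lia]
  have hdown : ∀ j < h, lay (par^[h - j] (p 0)) + (h - j) = i := fun j hj => by
    have := hL.lay_iterate (v := p 0) (j := h - j) (by lia)
    lia
  have hup : ∀ j ≤ h, lay (par^[j] (p l)) + j = i := fun j hj => by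
    have := hL.lay_iterate (v := p l) (j := j) (by lia)
    lia
  have cases_t : ∀ t ≤ l + 2 * h - 1, t ≤ l ∨ (∃ j, 1 ≤ j ∧ j ≤ h ∧ t = l + j) ∨
      ∃ j, 1 ≤ j ∧ j < h ∧ t = l + h + j := fun t ht => by
    by_cases h1 : t ≤ l
    · exact Or.inl h1
    by_cases h2 : t ≤ l + h
    · exact Or.inr (Or.inl ⟨t - l, by lia, by lia, by lia⟩)
    · exact Or.inr (Or.inr ⟨t - l - h, by lia, by lia, by lia⟩)
  have hq : G.IsPathSeq (l + 2 * h - 1) q := by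
    refine ⟨fun t ht => ?_, ?_⟩
    · by_cases h1 : t < l
      · rw [hq₁ t h1.le, hq₁ _ h1]
        exact hp.1 t h1
      by_cases h2 : t < l + h
      · obtain ⟨j, rfl⟩ := Nat.exists_eq_add_of_le (not_lt.1 h1)
        rw [hq₂ j (by lia), add_assoc, hq₂ (j + 1) (by lia)]
        exact hL.adj_iterate (by lia)
      · obtain ⟨j, rfl⟩ := Nat.exists_eq_add_of_le (not_lt.1 h2)
        rw [hq₃ j (by lia), add_assoc (l + h), hq₃ (j + 1) (by lia),
          show h - j = h - (j + 1) + 1 by lia]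
        exact (hL.adj_iterate (by lia)).symm
    · have key : ∀ s t, s < t → t ≤ l + 2 * h - 1 → q s ≠ q t := by
        intro s t hst ht he
        rcases cases_t s (by lia) with hs | ⟨a, ha1, ha, rfl⟩ | ⟨a, ha1, ha, rfl⟩ <;>
        rcases cases_t t ht with ht' | ⟨b, hb1, hb, rfl⟩ | ⟨b, hb1, hb, rfl⟩ <;> try lia
        · rw [hq₁ s hs, hq₁ t ht'] at he
          have := hp.2 s hs t ht' he
          lia
        · rw [hq₁ s hs, hq₂ b hb] at he
          have h1 := hlay s hs
          have h2 := hup b hb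
          rw [he] at h1
          lia
        · rw [hq₁ s hs, hq₃ b hb] at he
          have h1 := hlay s hs
          have h2 := hdown b hb
          rw [he] at h1
          lia
        · rw [hq₂ a ha, hq₂ b hb] at he
          have h1 := hup a ha
          have h2 := hup b hb
          rw [he] at h1
          lia
        · rw [hq₂ a ha, hq₃ b hb] at he
          have h1 := hup a ha
          have h2 := hdown b hb
          rw [he] at h1
          obtain rfl : a = h - b := by lia
          exact hne _ (by lia) he.symm
        · rw [hq₃ a ha, hq₃ b hb] at he
          have h1 := hdown a ha
          have h2 := hdown b hb
          rw [he] at h1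
          lia
      intro s hs t ht he
      rcases lt_trichotomy s t with hlt | heq | hlt
      · exact (key s t hlt ht he).elim
      · exact heq
      · exact (key t s hlt hs he.symm).elim
  have hclose : G.Adj (q (l + 2 * h - 1)) (q 0) := by
    have := hq₃ (h - 1) (by lia)
    rw [show l + h + (h - 1) = l + 2 * h - 1 by lia, show h - (h - 1) = 0 + 1 by lia] at this
    rw [this, hq₁ 0 (by lia)]
    exact (hL.adj_iterate (by lia)).symm
  obtain ⟨v, c, hc, hlen⟩ := hq.exists_isCycle (by lia) hclose
  exact ⟨v, c, hc, by lia⟩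

/-- A set `X` of at least two vertices of layer `i` splits into two parts such that any two vertices
from different parts have their first common ancestor in the same layer `i - h`. -/
theorem exists_partition (hL : G.IsLayering lay par root) {i : ℕ} {X : Set V}
    (hX : ∀ x ∈ X, lay x = i) (hroot : ∀ x ∈ X, ∀ y ∈ X, root x = root y)
    (hnt : X.Nontrivial) :
    ∃ (h : ℕ) (c : V → Prop), 1 ≤ h ∧ h ≤ i ∧ (∃ x ∈ X, c x) ∧ (∃ x ∈ X, ¬ c x) ∧
      ∀ x ∈ X, ∀ y ∈ X, c x → ¬ c y →
        (∀ j < h, par^[j] x ≠ par^[j] y) ∧ par^[h] x = par^[h] y := by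
  classical
  have hi : ∀ x ∈ X, ∀ y ∈ X, par^[i] x = par^[i] y := fun x hx y hy => by
    have h1 := hL.iterate_lay x
    have h2 := hL.iterate_lay y
    rw [hX x hx] at h1
    rw [hX y hy] at h2
    rw [h1, h2, hroot x hx y hy]
  have hex : ∃ h, ∀ x ∈ X, ∀ y ∈ X, par^[h] x = par^[h] y := ⟨i, hi⟩
  have hspec := Nat.find_spec hex
  have hmin : ∀ j < Nat.find hex, _ := fun j hj => Nat.find_min hex hj
  have hle : Nat.find hex ≤ i := Nat.find_min' hex hi
  set h := Nat.find hex
  have h1 : 1 ≤ h := by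
    by_contra h0
    obtain ⟨x, hx, y, hy, hxy⟩ := hnt
    have := hspec x hx y hy
    rw [show h = 0 by lia] at this
    exact hxy this
  have := hmin (h - 1) (by lia)
  push Not at this
  obtain ⟨x, hx, y, hy, hxy⟩ := this
  refine ⟨h, fun z => par^[h - 1] z = par^[h - 1] x, h1, hle, ⟨x, hx, rfl⟩, ⟨y, hy, hxy.symm⟩,
    fun a ha b hb hca hcb => ⟨fun j hj he => hcb ?_, hspec a ha b hb⟩⟩
  have hj' : h - 1 = (h - 1 - j) + j := by lia
  show par^[h - 1] b = par^[h - 1] x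
  rw [← hca, hj', Function.iterate_add_apply, Function.iterate_add_apply, he]

end IsLayering

/-- The edges of `G` inside layer `i`. -/
def withinLayer (G : SimpleGraph V) (lay : V → ℕ) (i : ℕ) : SimpleGraph V where
  Adj v w := G.Adj v w ∧ lay v = i ∧ lay w = i
  symm := ⟨fun _ _ h => ⟨h.1.symm, h.2.2, h.2.1⟩⟩
  loopless := ⟨fun _ h => G.irrefl h.1⟩

/-- The edges of `G` between layers `i` and `i + 1`. -/
def betweenLayers (G : SimpleGraph V) (lay : V → ℕ) (i : ℕ) : SimpleGraph V where
  Adj v w := G.Adj v w ∧ (lay v = i ∧ lay w = i + 1 ∨ lay v = i + 1 ∧ lay w = i)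
  symm := ⟨fun _ _ h => ⟨h.1.symm, h.2.symm.imp And.symm And.symm⟩⟩
  loopless := ⟨fun _ h => G.irrefl h.1⟩

open Classical in
theorem two_mul_ncard_edgeSet [Fintype V] (G : SimpleGraph V) :
    2 * G.edgeSet.ncard = (Finset.univ.filter fun x : V × V => G.Adj x.1 x.2).card := by
  rw [Set.ncard_eq_toFinset_card', ← edgeFinset, ← sum_degrees_eq_twice_card_edges,
    Finset.card_filter, Fintype.sum_prod_type]
  refine Finset.sum_congr rfl fun v _ => ?_
  rw [← card_neighborFinset_eq_degree, neighborFinset_eq_filter, Finset.card_filter]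

open Classical in
/-- In a layering of a graph of average degree at least `6k`, some layer or some pair of consecutive
layers spans a subgraph of average degree at least `2k`. -/
theorem exists_dense_layers [Fintype V] [Nonempty V] {G : SimpleGraph V} {lay : V → ℕ}
    (hlay : ∀ v w, G.Adj v w → lay v ≤ lay w + 1) {k : ℕ}
    (havg : 6 * k * Fintype.card V ≤ 2 * G.edgeSet.ncard) :
    ∃ i, ∃ S : Finset V, S.Nonempty ∧
      (2 * k * S.card ≤ ((S ×ˢ S).filter fun x => (G.withinLayer lay i).Adj x.1 x.2).card ∨
       2 * k * S.card ≤ ((S ×ˢ S).filter fun x => (G.betweenLayers lay i).Adj x.1 x.2).card) := by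
  by_contra! hcon
  set L : ℕ → Finset V := fun i => Finset.univ.filter fun v => lay v = i with hLdef
  set N := Finset.univ.sup lay + 1 with hN
  have hlt : ∀ v, lay v < N := fun v => by
    have := Finset.le_sup (f := lay) (Finset.mem_univ v)
    lia
  have hdisj : ∀ i, Disjoint (L i) (L (i + 1)) := fun i => by
    rw [Finset.disjoint_left]
    intro v h1 h2
    simp only [hLdef, Finset.mem_filter] at h1 h2
    lia
  set W : ℕ → Finset (V × V) := fun i =>
    (L i ×ˢ L i).filter fun x => (G.withinLayer lay i).Adj x.1 x.2 with hW
  set B : ℕ → Finset (V × V) := fun i =>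
    ((L i ∪ L (i + 1)) ×ˢ (L i ∪ L (i + 1))).filter
      fun x => (G.betweenLayers lay i).Adj x.1 x.2 with hB
  have hWle : ∀ i, (L i).Nonempty → (W i).card < 2 * k * (L i).card := fun i h =>
    (hcon i _ h).1
  have hBle : ∀ i, (B i).card ≤ 2 * k * ((L i).card + (L (i + 1)).card) := fun i => by
    rw [← Finset.card_union_of_disjoint (hdisj i)]
    rcases (L i ∪ L (i + 1)).eq_empty_or_nonempty with h | h
    · simp only [hB, h, Finset.empty_product, Finset.filter_empty, Finset.card_empty]
      exact Nat.zero_le _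
    · exact (hcon i _ h).2.le
  have hWle' : ∀ i, (W i).card ≤ 2 * k * (L i).card := fun i => by
    rcases (L i).eq_empty_or_nonempty with h | h
    · simp [hW, h]
    · exact (hWle i h).le
  have hsum : (Finset.univ.filter fun x : V × V => G.Adj x.1 x.2).card ≤
      ∑ i ∈ Finset.range N, ((W i).card + (B i).card) := by
    rw [Finset.card_eq_sum_card_fiberwise (t := Finset.range N)
      (f := fun x : V × V => min (lay x.1) (lay x.2))
      (fun x _ => by simpa using Or.inl (hlt x.1))]
    refine Finset.sum_le_sum fun i _ => (Finset.card_le_card ?_).trans (Finset.card_union_le _ _)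
    rintro ⟨v, w⟩ h
    simp only [Finset.mem_filter, Finset.mem_univ, true_and] at h
    have h1 := hlay v w h.1
    have h2 := hlay w v h.1.symm
    simp only [hW, hB, hLdef, withinLayer, betweenLayers, Finset.mem_union, Finset.mem_filter,
      Finset.mem_product, Finset.mem_univ, true_and, h.1]
    lia
  have hcard : ∑ i ∈ Finset.range N, (L i).card = Fintype.card V := by
    rw [← Finset.card_univ, Finset.card_eq_sum_card_fiberwise (t := Finset.range N) (f := lay)
      (fun x _ => by simpa using hlt x)]
  have hcard' : ∑ i ∈ Finset.range N, (L (i + 1)).card ≤ Fintype.card V := by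
    have h : Fintype.card V = ∑ b ∈ Finset.range (N + 1), (L b).card := by
      rw [← Finset.card_univ, Finset.card_eq_sum_card_fiberwise (t := Finset.range (N + 1))
        (f := lay) (fun x _ => by simpa using (hlt x).le)]
    rw [Finset.sum_range_succ'] at h
    lia
  have hstrict : ∑ i ∈ Finset.range N, ((W i).card + (B i).card) <
      ∑ i ∈ Finset.range N,
        (2 * k * (L i).card + 2 * k * ((L i).card + (L (i + 1)).card)) := by
    obtain ⟨v⟩ := ‹Nonempty V›
    exact Finset.sum_lt_sum (fun i _ => Nat.add_le_add (hWle' i) (hBle i))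
      ⟨lay v, by simpa using hlt v,
        Nat.add_lt_add_of_lt_of_le (hWle _ ⟨v, by simp [hLdef]⟩) (hBle _)⟩
  simp only [Finset.sum_add_distrib, ← Finset.mul_sum, hcard] at hstrict hsum
  rw [two_mul_ncard_edgeSet] at havg
  have := Nat.mul_le_mul_left (2 * k) hcard'
  nlinarith

/-- Cycles obtained by closing up, through the first common ancestors of their ends, paths inside a
cycle with a chord that does not reach below layer `i`. The predicate `P` selects the lengths of the
paths. -/
theorem IsLayering.exists_forall_isCycle {G H : SimpleGraph V} {lay : V → ℕ} {par root : V → V}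
    (hL : G.IsLayering lay par root) (hHG : H ≤ G) {i : ℕ}
    {n r : ℤ} {f : ℤ → V} (hf : H.IsCyclicSeq n f) (hr : H.Adj (f 0) (f r)) (hr2 : 2 ≤ r)
    (hrn : r + 2 ≤ n) (hlay : ∀ x, i ≤ lay (f x)) {x₀ y₀ : ℤ} (hx₀ : lay (f x₀) = i)
    (hy₀ : lay (f y₀) = i) (hne : f x₀ ≠ f y₀) (P : ℕ → Prop)
    (hend : ∀ l p, P l → H.IsPathSeq l p → (∀ t, p t ∈ Set.range f) → lay (p 0) = i →
      lay (p l) = i)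
    (hconst : ∀ l (C : ℤ → Prop), P l → Function.Periodic C l → Function.Periodic C 2 →
      ∀ x y, lay (f x) = i → lay (f y) = i → C x → C y) :
    ∃ h, 1 ≤ h ∧ ∀ l : ℕ, P l → 0 < l → l < n →
      ∃ (v : V) (c : G.Walk v v), c.IsCycle ∧ c.length = 2 * h + l := by
  have hroot : ∀ x, root (f x) = root (f 0) := fun x => by
    have h1 : Function.Periodic (fun x => root (f x)) 1 := fun x =>
      (hL.root_eq _ _ (hHG (hf.2.1 x))).symm
    simpa using h1.int_mul x 0
  obtain ⟨h, c, hh, hhi, ⟨x, ⟨⟨sx, rfl⟩, hx⟩, hcx⟩, ⟨y, ⟨⟨sy, rfl⟩, hy⟩, hcy⟩, hsep⟩ :=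
    hL.exists_partition (i := i) (X := {x | x ∈ Set.range f ∧ lay x = i}) (fun x hx => hx.2)
      (by rintro _ ⟨⟨s, rfl⟩, -⟩ _ ⟨⟨t, rfl⟩, -⟩; rw [hroot s, hroot t])
      ⟨f x₀, ⟨⟨_, rfl⟩, hx₀⟩, f y₀, ⟨⟨_, rfl⟩, hy₀⟩, hne⟩
  refine ⟨h, hh, fun l hPl hl hln => ?_⟩
  obtain ⟨p, hp, hpf, ⟨hc0, hp0⟩, hcl⟩ : ∃ p, H.IsPathSeq l p ∧ (∀ t, p t ∈ Set.range f) ∧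
      (c (p 0) ∧ lay (p 0) = i) ∧ ¬ (c (p l) ∧ lay (p l) = i) := by
    by_contra! hcon
    obtain ⟨h1, h2⟩ := hf.periodic_of_forall_isPathSeq hr hr2 hrn hl hln
      (fun v => c v ∧ lay v = i) hcon
    exact hcy (hconst l _ hPl h1 h2 sx sy hx hy ⟨hcx, hx⟩).1
  have hpl := hend l p hPl hp hpf hp0
  obtain ⟨h1, h2⟩ := hsep _ ⟨hpf 0, hp0⟩ _ ⟨hpf l, hpl⟩ hc0 fun hc => hcl ⟨hc, hpl⟩
  refine hL.exists_isCycle ⟨fun t ht => hHG (hp.1 t ht), hp.2⟩ hl (fun t _ => ?_) hp0 hpl hh hhi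
    h1 h2
  obtain ⟨s, hs⟩ := hpf t
  rw [← hs]
  exact hlay s

end SimpleGraph

open SimpleGraph in
/-- Let `k ≥ 2` and let `G` be a graph of finite girth `g` with
average degree at least `6k`. Then for some odd `r ≥ 3`, `G` contains cycles of
every even length in `[r, r + (g − 2)k]`, or cycles of every odd length in
`[r, r + (g − 2)k]`. -/
theorem consecutive_even_or_odd_cycle_lengths
    {V : Type*} [Fintype V] [Nonempty V] (G : SimpleGraph V) (k g : ℕ)
    (hk : 2 ≤ k)
    (hgirth : G.girth = (g : ℕ∞))
    (havg : 6 * k * Fintype.card V ≤ 2 * G.edgeSet.ncard) :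
    ∃ r : ℕ, Odd r ∧ 3 ≤ r ∧
      ((∀ m : ℕ, Even m → r ≤ m → m ≤ r + (g - 2) * k →
          ∃ (v : V) (c : G.Walk v v), c.IsCycle ∧ c.length = m) ∨
       (∀ m : ℕ, Odd m → r ≤ m → m ≤ r + (g - 2) * k →
          ∃ (v : V) (c : G.Walk v v), c.IsCycle ∧ c.length = m)) := by
  classical
  have hg : G.girth = g := by exact_mod_cast hgirth
  obtain ⟨lay, par, root, hL⟩ := G.exists_isLayering
  have hlong : ∀ H : SimpleGraph V, H ≤ G → ∀ S : Finset V, S.Nonempty →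
      2 * k * S.card ≤ ((S ×ˢ S).filter fun x => H.Adj x.1 x.2).card →
      ∃ (n r : ℤ) (f : ℤ → V), H.IsCyclicSeq n f ∧ H.Adj (f 0) (f r) ∧ 2 ≤ r ∧ r + 2 ≤ n ∧
        (((g - 2) * k + 2 : ℕ) : ℤ) ≤ n := fun H hHG S hS hcard => by
    obtain ⟨T, hT, hdeg⟩ := exists_subset_forall_lt_card_neighbors H (by lia) hS hcard
    refine exists_isCyclicSeq_chord hk (fun v c hc => ?_) hT hdeg
    have := girth_le_length (hc.mapLe hHG)
    simpa [hg] using this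
  obtain ⟨i, S, hS, hcard | hcard⟩ := exists_dense_layers hL.lay_le havg
  · have hHG : G.withinLayer lay i ≤ G := fun _ _ h => h.1
    obtain ⟨n, r, f, hf, hr, hr2, hrn, hn⟩ := hlong _ hHG S hS hcard
    have hlay : ∀ x, lay (f x) = i := fun x => (hf.2.1 x).2.1
    obtain ⟨h, hh, hcyc⟩ := hL.exists_forall_isCycle hHG hf hr hr2 hrn (fun x => (hlay x).ge)
      (hlay 0) (hlay 1) (hHG (by simpa using hf.2.1 0)).ne Odd
      (fun l p _ _ hpf _ => by obtain ⟨x, hx⟩ := hpf l; rw [← hx, hlay])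
      (fun l C ⟨m, hm⟩ h1 h2 x y _ _ hC => by
        have h3 : Function.Periodic C 1 := by
          have := h1.sub_period (h2.int_mul m)
          rwa [Int.cast_id, show (l : ℤ) - (m : ℤ) * 2 = 1 by lia] at this
        have := h3.int_mul (y - x) x
        rw [Int.cast_id, show x + (y - x) * 1 = y by ring] at this
        rwa [this])
    refine ⟨2 * h + 1, ⟨h, rfl⟩, by lia, Or.inr fun m ⟨t, ht⟩ hm hm' => ?_⟩
    obtain ⟨v, c, hc, hlen⟩ := hcyc (m - 2 * h) ⟨t - h, by lia⟩ (by lia) (by lia)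
    exact ⟨v, c, hc, by lia⟩
  · have hHG : G.betweenLayers lay i ≤ G := fun _ _ h => h.1
    obtain ⟨n, r, f, hf, hr, hr2, hrn, hn⟩ := hlong _ hHG S hS hcard
    have hstep : ∀ v w, (G.betweenLayers lay i).Adj v w → (lay w = i ↔ ¬ lay v = i) :=
      fun v w h => by have := h.2; lia
    have hlay : ∀ x, i ≤ lay (f x) := fun x => by have := (hf.2.1 x).2; lia
    have hper : Function.Periodic (fun x => lay (f x) = i) 2 := fun x => by
      have h1 := hstep _ _ (hf.2.1 x)
      have h2 := hstep _ _ (hf.2.1 (x + 1))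
      rw [add_assoc] at h2
      exact propext (h2.trans (by rw [h1, not_not]))
    obtain ⟨x₀, hx₀⟩ : ∃ x, lay (f x) = i := by
      by_cases h0 : lay (f 0) = i
      · exact ⟨0, h0⟩
      · exact ⟨0 + 1, (hstep _ _ (hf.2.1 0)).2 h0⟩
    have heven : ∀ x y, lay (f x) = i → lay (f y) = i → Even (y - x) := fun x y hx hy => by
      by_contra hodd
      obtain ⟨m, hm⟩ := Int.not_even_iff_odd.1 hodd
      have h1 := hper.int_mul m (x + 1)
      rw [Int.cast_id, show x + 1 + m * 2 = y by lia] at h1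
      exact (hstep _ _ (hf.2.1 x)).1 (h1 ▸ hy) hx
    obtain ⟨h, hh, hcyc⟩ := hL.exists_forall_isCycle hHG hf hr hr2 hrn hlay hx₀
      (Eq.mpr (hper x₀) hx₀ : lay (f (x₀ + 2)) = i)
      (fun he => by have := hf.2.2 _ _ (by lia) (by lia) he; lia) Even
      (fun l p hl hp _ h0 => by
        have : ∀ t ≤ l, (lay (p t) = i ↔ Even t) := fun t => by
          induction t with
          | zero => simp [h0]
          | succ t ih =>
            intro ht
            rw [hstep _ _ (hp.1 t ht), ih (by lia), Nat.even_add_one]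
        exact (this l le_rfl).2 hl)
      (fun l C _ _ h2 x y hx hy hC => by
        obtain ⟨m, hm⟩ := heven x y hx hy
        have := h2.int_mul m x
        rw [Int.cast_id, show x + m * 2 = y by lia] at this
        rwa [this])
    refine ⟨2 * h + 1, ⟨h, rfl⟩, by lia, Or.inl fun m ⟨t, ht⟩ hm hm' => ?_⟩
    obtain ⟨v, c, hc, hlen⟩ := hcyc (m - 2 * h) ⟨t - h, by lia⟩ (by lia) (by lia)
    exact ⟨v, c, hc, by lia⟩
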